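/- There exist 62 distinct points in ℝ² and a set E of 124 unordered pairs of these points such that every point is an endpoint of exactly 4 pairs in E, the closed segments of any two distinct pairs intersect at most in a common endpoint, exactly 122 of the pairs join points at distance exactly 1, and the remaining 2 pairs join points at one common distance t with |t − 1| < 0.034. -/

import Mathlib

set_option linter.all false
namespace NM

theorem newton_aux {n : ℕ} (F : (Fin n → ℝ) → (Fin n → ℝ))
    (J : (Fin n → ℝ) → Matrix (Fin n) (Fin n) ℝ)
    (hF : ∀ x y, F x - F y = (J ((1/2 : ℝ) • (x + y))).mulVec (x - y))
    (B : Matrix (Fin n) (Fin n) ℝ) (y0 : Fin n → ℝ) (r : ℝ) (hr : 0 < r)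
    (h1 : ∀ z, ‖z - y0‖ ≤ r → ∀ i, ∑ j, |(1 - B * J z) i j| ≤ 1/2)
    (h2 : ∀ i, |(B.mulVec (F y0)) i| ≤ r / 2) :
    ∃ y, ‖y - y0‖ ≤ r ∧ F y = 0 := by
  have hmul : ∀ z, ‖z - y0‖ ≤ r → ∀ v : Fin n → ℝ, ‖(1 - B * J z).mulVec v‖ ≤ 1/2 * ‖v‖ := by
    intro z hz v
    rw [pi_norm_le_iff_of_nonneg (by positivity)]
    intro i
    rw [Matrix.mulVec, dotProduct, Real.norm_eq_abs]
    calc |∑ j, (1 - B * J z) i j * v j| ≤ ∑ j, |(1 - B * J z) i j * v j| :=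
          Finset.abs_sum_le_sum_abs _ _
      _ ≤ ∑ j, |(1 - B * J z) i j| * ‖v‖ := by
          apply Finset.sum_le_sum
          intro j _
          rw [abs_mul]
          exact mul_le_mul_of_nonneg_left (norm_le_pi_norm v j) (abs_nonneg _)
      _ = (∑ j, |(1 - B * J z) i j|) * ‖v‖ := by rw [Finset.sum_mul]
      _ ≤ 1/2 * ‖v‖ := mul_le_mul_of_nonneg_right (h1 z hz i) (norm_nonneg _)
  set G : (Fin n → ℝ) → (Fin n → ℝ) := fun y => y - B.mulVec (F y) with hG
  have hGd : ∀ x y, G x - G y = (1 - B * J ((1/2 : ℝ) • (x + y))).mulVec (x - y) := by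
    intro x y
    rw [Matrix.sub_mulVec, Matrix.one_mulVec, ← Matrix.mulVec_mulVec, ← hF, Matrix.mulVec_sub]
    simp only [hG]; abel
  have hmid : ∀ x y, ‖x - y0‖ ≤ r → ‖y - y0‖ ≤ r → ‖(1/2 : ℝ) • (x + y) - y0‖ ≤ r := by
    intro x y hx hy
    have : (1/2 : ℝ) • (x + y) - y0 = (1/2 : ℝ) • ((x - y0) + (y - y0)) := by
      ext i; simp; ring
    rw [this, norm_smul]
    have := norm_add_le (x - y0) (y - y0)
    norm_num
    linarith
  have hlip : ∀ x y, ‖x - y0‖ ≤ r → ‖y - y0‖ ≤ r → ‖G x - G y‖ ≤ 1/2 * ‖x - y‖ := by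
    intro x y hx hy
    rw [hGd]
    exact hmul _ (hmid x y hx hy) _
  have h0 : ‖G y0 - y0‖ ≤ r / 2 := by
    rw [pi_norm_le_iff_of_nonneg (by positivity)]
    intro i
    have := h2 i
    simp only [hG, Pi.sub_apply, Real.norm_eq_abs]
    rw [sub_sub_cancel_left, abs_neg]; exact this
  have hself : ∀ y, ‖y - y0‖ ≤ r → ‖G y - y0‖ ≤ r := by
    intro y hy
    have h3 := hlip y y0 hy (by simpa using hr.le)
    have : G y - y0 = (G y - G y0) + (G y0 - y0) := by abel
    rw [this]
    have := norm_add_le (G y - G y0) (G y0 - y0)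
    linarith
  let s : Set (Fin n → ℝ) := Metric.closedBall y0 r
  have hs : ∀ y, y ∈ s ↔ ‖y - y0‖ ≤ r := fun y => by simp [s, dist_eq_norm]
  have hmaps : Set.MapsTo G s s := fun y hy => (hs _).2 (hself y ((hs _).1 hy))
  have hcomp : IsComplete s := Metric.isClosed_closedBall.isComplete
  have hcon : ContractingWith (1/2 : NNReal) (hmaps.restrict G s s) := by
    refine ⟨by norm_num, ?_⟩
    apply LipschitzWith.of_dist_le_mul
    rintro ⟨x, hx⟩ ⟨y, hy⟩
    have := hlip x y ((hs _).1 hx) ((hs _).1 hy)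
    rw [Subtype.dist_eq, Subtype.dist_eq]
    simpa [dist_eq_norm] using this
  obtain ⟨y, hy, hfix, -⟩ := hcon.exists_fixedPoint' hcomp hmaps (x := y0)
    ((hs _).2 (by simpa using hr.le)) (edist_ne_top _ _)
  refine ⟨y, (hs y).1 hy, ?_⟩
  have hB : B.mulVec (F y) = 0 := by
    have : G y = y := hfix
    simpa [hG] using this
  have hinj : ∀ v : Fin n → ℝ, (B * J y0).mulVec v = 0 → v = 0 := by
    intro v hv
    have := hmul y0 (by simpa using hr.le) v
    rw [Matrix.sub_mulVec, hv, Matrix.one_mulVec, sub_zero] at this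
    have h5 := norm_nonneg v
    exact norm_eq_zero.1 (by linarith)
  have hdet : (B * J y0).det ≠ 0 := by
    intro h
    obtain ⟨v, hv, hv0⟩ := Matrix.exists_mulVec_eq_zero_iff.2 h
    exact hv (hinj v hv0)
  have hBdet : B.det ≠ 0 := by
    intro h; apply hdet; rw [Matrix.det_mul, h, zero_mul]
  by_contra hne
  exact hBdet (Matrix.exists_mulVec_eq_zero_iff.1 ⟨F y, hne, hB⟩)
def dec (N w k : ℕ) : ℕ := (N >>> (w * k)) % 2 ^ w

def Y0 (j : ℕ) : ℤ := (dec 0x4bb80e3bf0b14c412e49ab094597d84892ba54d00653ec926879185cb6085bff8d4d839d5aa03c3ad8625b795c44ba276719c7564d124e26b1631efd69d86a35b79d69d86a19dee957f8932ffae6674bcd2eb9c9534157278e477404c23c4b7a4c46a630591c65df7021e59f4afe621f27d38068692e186a8382f72f774f4403b13b8df35b844d210cf166374829503a75057f3840d078200e3eeb7c6a665c291f5e586ee911d83264f2c42118a765691a18598772c03e3d0900869d863d09003d0900 24 j : ℤ) - 4000000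

def ea (k : ℕ) : ℕ := dec 0x1fffffeef6f7e739cdeb57be2b58c1ce6b16b5a94a4a50841ce6318c52948418c631084208400 5 k

def eb (k : ℕ) : ℕ := dec 0x1ee8320cfbdddead8b637bd67389ca928b5d283e128ce6d6310f99d4f7528923cb42362961e0b 5 k

def Brows : List ℕ := [
0x20080200c0200802008020080200802008020080200802008020080200802008020080200802008020080200802008020080200802008020080200802008020080200802008020080200802008020080200,
0x2008030080200802008020080200802008020080200802008020080200802008020080200802008020080200802008020080200802008020080200802008020080200802008020080200802008020080200,
0x20080200c0200802008020080200802008020080200802008020080200802003820089651371e97e600801e7a0e5181324bb7207a6179889dbae96b15a769e0089720314c58020084e138020074a91a0df9,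
0x200c020080200802008020080200802008020080200802008020080200802008020080200802008020080200802008020080200802008020080200802008020080200802008020080200802008020080200,
0x200a0180c020080200802008020080200802008020080200802008020080200b1e008fde7aa5ec90a0080232989e7775575617673a327f6615f63a8cdf57d6008fd39a1a8680200925d5882206ea0f98a42,
0x200aee4580200802008020080200802008020080200802008020080200802007e20075e098e9a276200801fe84a09909c68421a7e208836277221b8660d8360075e0987a1e80200761a06fdbe66a16849d8,
0x2009859fc02008020080200802008020080200802008020080200802008020096200871cd961e38c6008024a9a9cd7f9a86e1c77a218806346e620871d4879b6749a8a067d92a4a761d88020172e0b9aa31,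
0x200a327480200802008020080200802008020080200802008020080200802009fe006ee0fa01d66f600801fe87e0f7f980661ae7762380a4b6662e8a61985e026f581aea3a7f9fe71dc7806016ce1087dbd,
0x200a596ac020080200802008020080200802008020080200802008020080200a2200935e5a25d393e0080232971e57f977641a876e2580a5064a318b1f07c200935789e6798020070dc3806016ba129724f,
0x200a2e7580200802008020080200802008020080200802008020080200802009f6006ea0e9f9d66f200801fe87e0e7f982665af7762380a4a66a2d8a618862006e9838ea3a80200721c8806016d21087dbc,
0x200915bbc0200802008020080200802008020080200802008020080200802008fe00809c08fdeb88600802579c5c07fdc1735d87be118062573617851c58d9dd77dc19727f77623791e48020076a089c621,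
0x20097ea1802008020080200802008020080200802008020080200802008020095a00649fa95de368e00802128a9fa7f9a96e5c87a218806336ea1f872018fa4174daa9fa3d905bf765d9802017320b8a9a3,
0x2007e607c0200802008020080200802008020080200802008020080200802007ea0080e1c7ea027d60080212a161c8020681604809fe801dc815fea2de679a0080e067ddf78020080e0380200811ffa15f5,
0x200a7a628020080200802008020080200802008020080200802008020080200a3e006d5efa41d171e0080216869ef7f57062da47662780ae46363480a358d6006d572b46d180200701c0806016a613869c7,
0x200845efc0200802008020080200802008020080200802008020080200802004da0089a3f4d1fc80a00801f49fe3f80ecca9abf7ee058e8f1a9288ab5b66da0089aca461188020086619802007de029fe02,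
0x200b3a3280200802008020080200802008020080200802008020080200802003ee007f6373ddc578e00801d88363780f09b5f2672e359e501b562a921d274a007f70541505802007b9ee8020063e18835e3,
0x200915bbc02008020080200802008020080200802008020080200802008020090e008a60691639882008021e9c606801bb725906865f7adf87265c98de5796008a5bd86e1b802008b22c7fdff76a089c620,
0x200b0e3d802008020080200802008020080200802008020080200802008020030e007f6432fdb877600801cf8424381341c17657762381ccbc0e34961c8722007f73d33ccf802007a9ea8020065617841dd,
0x2009859fc020080200802008020080200802008020080200802008020080200c6e008b1eab520d8c600802329a9ea6cd2c435326fa427da77582458f5fc7f2008b138a6298802008ddee925b872e0b9aa31,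
0x200a3e7180200802008020080200802008020080200802008020080200802009c6006f20d9e1d26fe00801fe87a0d81188691b97822080e4767e2c89e1785e006f2088de37802006f9c47ee076c611879bf,
0x200815fbc020080200802008020080200802008020080200802008020080200816007fa04815fe7f20080204a0a04801fb7f1fd7fe01802037f202809fe7fa007f9fb81e07802007f9fe802007f601a09fc,
0x2009aa9680200802008020080200802008020080200802008020080200802009820073a59981e06aa00802558a2597f9a06c5c279a1a80a386ca2387dcd73600739a0a328c80200755d58060171a0c8a1aa,
0x2008bdd1c0200802008020080200802008020080200802008020080200802008ae427aa288adf2769be6fa268d5e67fdd5775e47d20c806197760f839e97a6007a9d58fa3e802007b5ed8020079a069de14,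
0x200862e8802008020080200802008020080200802008020080200802008020085a227d614859f97b1de77a1386df3801ea7b9f27ea068020d7ba0881df47d2007d5ea88220802007d9f6802007ce038f57a,
0x2008d1ccc0200802008020080200802008020080200802008020080200802007b6008a2197b62685e00802119da1980613841f188271795a483e6a9edd675a008a213721c88020089a2680200792069da17,
0x200bd60b8020080200802008020080200802008020080200802008020080200722007fe0c71df37ea00801f780e0c806398ba3f7d5ed869c98ba0983df67da007fe38729ca802007f1fc802005ea1d80dfa,
0x2009a198c020080200802008020080200802008020080200802008020080200bea008ade0bfa008d6008023a9a1e07f9024c95371e397e6aa4ce3e8c20681a008ad06b2ecb802008e6397fdff71e0c9a235,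
0x200baa168020080200802008020080200802008020080200802008020080200642007fe1863d787d200801ef81a18806719726081df98599396e1287dec7b2007fe7065194802007e1f8802005fe1c819f4,
0x200979a2c0200802008020080200802008020080200802008020080200802009560074dcc959e48be008024b9adcc7f9aa6e9c97a617806326ee1f871d374e0074dab9f67d80200769da802007320b9ae2f,
0x2008c6cf80200802008020080200802008020080200802008020080200802008b2007a5e58b1f162200802278dde57fdd4771e47d20c8061a77210839e97a6007a5d490240802007b1ec80200796068dd88,
0x2008b1d4c0200802008020080200802008020080200802008020080200802008a2007adb58a1f384a00802629e1b57fdd877de67d60b806187820e8364c932007add88ea3a802007b9ee802007a2059e212,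
0x200a3a728020080200802008020080200802008020080200802008020080200a02006f60fa05d56fa00801fd87a0f7f97f659ad7762380a4c6622e8a615856006f580af2bc80200719c6806016ca11879be,
0x20080dfdc02008020080200802008020080200802008020080200802008020080a047fe02809ff7f9fc8120280dff801fe7f9fe7fe01802017fa01805ff7fe007fdfe80e03802007fdff802007fe00a0dfa,
0x2008d6cb80200802008020080200802008020080200802008020080200802008c24a79e2c8c1f0755b692a2a8f1e37fdd0765e17ce0d8061c7661183de779e0079dd091a46802007a9ea8020078e068d98b,
0x20092db5c020080200802008020080200802008020080200802008020080200d6a0087dedbd22589200802329c1ed8990c355006ca4e7c28752a4e916018060087d38a96a5802008aa018a5d775e099c224,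
0x200afe4180200802008020080200802008020080200802008020080200802007ae0076a098d19d76e00801fe846098f1cc86e247ea0683a247321985e0c8320076a0986e1b802007699d8fdc465e16845db,
0x2008c9cec0200802008020080200802008020080200802008020080200802008b63e7a22a8b5f175e3e70a288e1e47fdd376de37d20c8061b7721083de87a2007a1d390a42802007b1ec80200796069da16,
0x200936b38020080200802008020080200802008020080200802008020080200919d876e41919e9705d88a23e95dd57fdba71dd37b6138062971e1985ddb76e0076dba99a6680200785e18020075a098bd99,
0x2008b5d3c020080200802008020080200802008020080200802008020080200c1e00819e4c2e3f84e008023c9dde47f4f5298d56a2587aee23be539061585600818f9beafa8020085a168020079e059de13,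
0x200a4e6d802008020080200802008020080200802008020080200802008020095e006d5fb95dc4706008020d875fb7f9a9751e37ae1581eae50e2284a2b8ae006d5a9a6e9b802006f1bc806016be11875c1,
0x2009e986c0200802008020080200802008020080200802008020080200802009ba008cdd89bddb8fe008023f98dd87f991695b978a1e80a4169e28891e1821d971992a8a7b89dd9739ce806016f60e98e3f,
0x20097aa2802008020080200802008020080200802008020080200802008020095600641f9955e468a00802138adf97f9ab6e9c97a617806326ee1f86e008fdc1751ab9f23d8fdc1769da802007360b8ada2,
0x22980200c02008027a9ea0b8560082e15802007d9f6861e28021878a159e9d68020080200802008020080200802008020080200802008020080200802008020080200802008020080200802008020080200,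
0x2fd8030080200801ad6b69374e00a4dd38020070dc3a45dc802917720a62da68020080200802008020080200802008020080200802008020080200802008020080200802008020080200802008020080200,
0x12980200c02008027a9ea0b8560082e15802007d9f6861e28021878a159e9d68020080200802008020080200802008020080200802008020080200802008020080200802008020080200802008020080200,
0x2fd8030080200801ad6b6936f200a4dbc8020092649a11f7802847de1e5c6318020080200802008020080200802008020080200802008020080200802008020080200802008020080200802008020080200,
0x17280200c02008027a9ea0b7c20082df08020088e236b9ce801ae73a33945e48020080200802008020080200802008020080200802008020080200802008020080200802008020080200802008020080200,
0x2618030080200801ad6b69382e00a4e0b802007a5e98de2280237889de726138020080200802008020080200802008020080200802008020080200802008020080200802008020080200802008020080200,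
0x1d580200c02008027a9ea0b6f60082dbd8020082e0b79e46801e791a5c865f88020080200802008020080200802008020080200802008020080200802008020080200802008020080200802008020080200,
0x2ed8030080200801ad6b69371200a4dc480200719c6a21ee802887ba175e62e8020080200802008020080200802008020080200802008020080200802008020080200802008020080200802008020080200,
0x20c80200c02008027a9ea0b7de0082df7802007f5fd81e0480207811fc7e6028020080200802008020080200802008020080200802008020080200802008020080200802008020080200802008020080200,
0x2ac8030080200801ad6b69360200a4d8080200759d698e3c802638f1c367e218020080200802008020080200802008020080200802008020080200802008020080200802008020080200802008020080200,
0x1a380200c02008027a9ea0b75e0082dd78add585e4172dc1755f58a6478d5ee8020080200802008020080200802008020080200802008020080200802008020080200802008020080200802008020080200,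
0x2a78030080200801ad6b69379e00a4de78f1c4762149820f7129c715fa686208020080200802008020080200802008020080200802008020080200802008020080200802008020080200802008020080200,
0x14d80200c02008027a9ea0b80a0082e027861f8ae0c665d87860d7de24995dd8020080200802008020080200802008020080200802008020080200802008020080200802008020080200802008020080200,
0x2af8030080200801ad6b69378e00a4de390dbd75a199920c90e9a725fe676228020080200802008020080200802008020080200802008020080200802008020080200802008020080200802008020080200,
0x17f80200c02008027a9ea0b7a60082de992a4a87e2b6d9cb6d9ff85238925e78020080200802008020080200802008020080200802008020080200802008020080200802008020080200802008020080200,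
0x2f58030080200801ad6b69370200a4dc07e5f971644a35f981e867ce1b5d6308020080200802008020080200802008020080200802008020080200802008020080200802008020080200802008020080200,
0x1bf80200c01be90a7a8e20b7e64272230802008421076de9801db7a617895f38020080200802008020080200802008020080200802008020080200802008020080200802008020080200802008020080200,
0x28680300801e0881ad6369383e209cd9c8020077ddf9362f8024d8bdd06d21a8020080200802008020080200802008020080200802008020080200802008020080200802008020080200802008020080200,
0x1b980200c01c38f67a8f60b7e1c370e35802008461175de7801d779e198a1f28020080200802008020080200802008020080200802008020080200802008020080200802008020080200802008020080200,
0x230803008022975dad75e93816298a5dc802007d1f4872118021c845ef796098020080200802008020080200802008020080200802008020080200802008020080200802008020080200802008020080200,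
0x20680200c01fb7ee7a7ee0b80605815fb802007fdff8120280204809fe7f2018020080200802008020080200802008020080200802008020080200802008020080200802008020080200802008020080200,
0x25680300801b66d9ad6da9382a4a929c0802007adeb8c61e80231879e173e118020080200802008020080200802008020080200802008020080200802008020080200802008020080200802008020080200,
0x200802008020080200802008020080200802008020080200802008020080200726007addb71ded802008021e801db7fd3993e4584ded816d94f9ef75e2b8ae007ad3db46d1802007ddf6809ff8020080200]

def colsD : List (List (ℕ × ℤ)) := [
[(0, -914786), (1, -1997644), (56, -1121712), (58, -1994844), (61, 1000000)],
[(0, 1778530), (1, 97036), (56, -1655826), (58, 143518), (62, 1000000)],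
[(2, 1899248), (3, 406814)],
[(2, 626784), (3, 1958188), (63, 1000000)],
[(4, 1642988), (5, -166152), (6, -1790038), (7, 1809140)],
[(4, -1140436), (5, -1993088), (6, -892056), (7, 852650)],
[(8, 1761550), (9, 1700962), (10, -60588), (11, 60588)],
[(8, 947068), (9, -1052014), (10, -1999082), (11, 1999082)],
[(7, -1809140), (11, -60588), (12, -166152), (13, 1700962)],
[(7, -852650), (11, -1999082), (12, -1993086), (13, -1052014)],
[(9, -1700962), (14, 60588), (15, 1761550), (16, -1761550)],
[(9, 1052014), (14, 1999082), (15, 947070), (16, -947068)],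
[(17, 1950750), (18, -1799012), (19, 406814), (20, 593368)],
[(17, 441106), (18, 873816), (19, 1958188), (20, 1909952)],
[(2, -1899248), (18, 1799012), (21, 406814), (22, -1492434)],
[(2, -626784), (18, -873816), (21, 1958188), (22, 1331404)],
[(21, -406814), (23, -1899248), (24, -1492436), (25, 1799012)],
[(21, -1958188), (23, -626784), (24, 1331406), (25, -873816)],
[(4, -1642988), (12, 166152), (26, -141578), (27, -1809140)],
[(4, 1140436), (12, 1993086), (26, -1956842), (27, -852652)],
[(17, -1950750), (28, 1082860), (29, 1997646), (30, -1357382)],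
[(17, -441106), (28, 1681492), (29, -97038), (30, 1468846)],
[(0, 914786), (31, -1082858), (32, -1997644), (33, -914786)],
[(0, -1778530), (31, -1681494), (32, 97036), (33, 1778528)],
[(3, -406814), (22, 1492434), (23, 1899248), (34, 406812)],
[(3, -1958188), (22, -1331404), (23, 626784), (34, 1958190)],
[(6, 1790038), (24, 1492436), (34, -406812), (35, 1623886)],
[(6, 892056), (24, -1331406), (34, -1958190), (35, -1101032)],
[(15, -1761550), (33, 914786), (36, -1082858), (37, -1700962)],
[(15, -947070), (33, -1778528), (36, -1681492), (37, 1052012)],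
[(10, 60588), (16, 1761550), (20, -593368), (30, 1357382)],
[(10, 1999082), (16, 947068), (20, -1909952), (30, -1468846)],
[(1, 1997644), (29, -1997646), (31, 1082858), (38, -914786)],
[(1, -97036), (29, 97038), (31, 1681494), (38, 1778530)],
[(5, 166152), (27, 1809140), (35, -1623886), (39, 1667562)],
[(5, 1993088), (27, 852652), (35, 1101032), (39, -1104190)],
[(28, -1082860), (32, 1997644), (36, 1082858), (38, 914786)],
[(28, -1681492), (32, -97036), (36, 1681492), (38, -1778530)],
[(19, -406814), (25, -1799012), (26, 141578), (39, -1667562)],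
[(19, -1958188), (25, 873816), (26, 1956842), (39, 1104190)],
[(8, -1761550), (13, -1700962), (14, -60588), (37, 1700962)],
[(8, -947068), (13, 1052014), (14, -1999082), (37, -1052012)],
[(40, 359750), (41, 1883676), (64, 1000000)],
[(40, -1967380), (41, -672138)],
[(47, 1814970), (49, 179876), (64, -1000000)],
[(47, 840170), (49, 1991894)],
[(43, -1635094), (44, -1814968), (52, -873130), (53, 1121714)],
[(43, 1151722), (44, -840172), (52, 1799344), (53, 1655826)],
[(40, -359750), (42, 1523926), (46, 1635094), (48, -179874)],
[(40, 1967380), (42, 1295242), (46, -1151724), (48, -1991894)],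
[(41, -1883676), (42, -1523926), (55, 873132), (57, 1994844)],
[(41, 672138), (42, -1295242), (55, -1799344), (57, -143518)],
[(43, 1635094), (45, -179874), (46, -1635094), (50, -1814968)],
[(43, -1151722), (45, -1991894), (46, 1151724), (50, -840170)],
[(44, 1814968), (45, 179874), (47, -1814970), (51, -1635094)],
[(44, 840172), (45, 1991894), (47, -840170), (51, 1151724)],
[(48, 179874), (49, -179876), (50, 1814968), (51, 1635094)],
[(48, 1991894), (49, -1991894), (50, 840170), (51, -1151724)],
[(52, 873130), (54, 1994844), (55, -873132), (59, 1121712)],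
[(52, -1799344), (54, -143518), (55, 1799344), (59, 1655826)],
[(53, -1121714), (54, -1994844), (56, 1121712), (60, -873132)],
[(53, -1655826), (54, 143518), (56, 1655826), (60, 1799344)],
[(57, -1994844), (58, 1994844), (59, -1121712), (60, 873132)],
[(57, 143518), (58, -143518), (59, -1655826), (60, -1799344)],
[(26, -1000000), (35, -1000000)]]

def F0l : List ℤ := [596674, -615992, 287040, -531515, 959560, 1565712, -12855, -109475, -950219, 1295410, -62883, -62883, -427375, 1295410, -62883, -3150, -950219, 16434, -355500, -531515, 556432, -531515, -1036107, 287040, 1787733, -355500, 735762, 743176, 281416, 1478690, -1383590, 880050, -615992, -1181855, 1019861, 1301505, -801443, 243397, 596674, -355014, 1031725, 1191005, 573010, -1011470, -542348, -909222, 140253, 432450, -909222, -729347, -1382519, 140253, -1293191, 510018, 165, -420060, -611695, 165, 165, -611695, -420060, 0, 0, 0, 0]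

def PX (v : ℕ) : ℤ := (dec 0x67131470db9a761b6b8887428b6b757cffbd6c52e67a1b897fe3f07f5e808e9f2287601c89a7b296c9dd897e94781f7a7c5c6a96a0bf96f2fb6d8c225c937152caec4d8b1a3b1f44383b1046a6c957539f498afd43c29561d3434448063507633c466939fed32cdca93a27f14b870c474a1c2d05c72cb38b561a6457f893674bcd5341577404c24c46a665df704afe628068698382f74403b15b844d66374875057f78200e6a665c586ee964f2c465691a72c03e869d863d0900 24 v : ℤ) - 4000000

def PY (v : ℕ) : ℤ := (dec 0x806dbb8c236c7dcf99708b0b7f86857a89d07219e76b8e5689854b4a76af4a06575774066e0a566645b65ec84e57e45f668cee5703ae7587bf62e43c806dbb8c236c7dcf99708b0b7f86857a89d07219e76b8e5689854b8ec18e4a76af4a06575774066e0a566645b65ec84e57e45f668cee5703ae7587bf62e43c19dee92ffae62eb9c9278e473c4b7a30591c21e59f1f27d32e186a2f774f3b8df3210cf129503a3840d03eeb7c291f5e11d8322118a71859873d09003d0900 24 v : ℤ) - 4000000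

def kd (v : ℕ) : ℕ := dec 0x249249236db6db6d2492492249249248000000000000000 3 v

def bi (v : ℕ) : ℕ := dec 0x3feef37ace2fff779bd6717b57feef37ace2e0ffbbcdeb38bdab49ca307b9ac5a928398a418820 5 v

def VT (κ i : ℕ) : ℕ := dec 0xf7cefae78df6d6ba80000000000000000000000000000020d33cb1c2fbadb2ba80000000000000000000000000000001a689e69648e28565400000000000000000000000000000207de75c6da6585d65400000000000000000000000000000000000000000000000144d24503ce34c2ca2481c61440c2040 6 (32 * κ + i)

def EN : List (ℕ × ℕ) := [(0, 11), (0, 16), (1, 7), (1, 12), (2, 9), (2, 17), (2, 13), (2, 4), (3, 20), (3, 5), (3, 15), (3, 4), (4, 9), (4, 20), (5, 20), (5, 14), (5, 15), (6, 10), (6, 7), (6, 19), (6, 15), (7, 8), (7, 12), (8, 12), (8, 13), (8, 19), (9, 19), (9, 17), (10, 18), (10, 16), (10, 15), (11, 16), (11, 18), (11, 14), (12, 13), (13, 17), (14, 18), (14, 20), (16, 18), (17, 19), (21, 24), (21, 25), (24, 25), (23, 26), (23, 27), (26, 27), (24, 26), (22, 27), (24, 28), (22, 28), (26, 28), (27,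 28), (23, 29), (23, 30), (29, 30), (25, 29), (0, 30), (25, 31), (0, 31), (29, 31), (30, 31), (21, 34), (21, 35), (34, 35), (33, 36), (33, 37), (36, 37), (34, 36), (22, 37), (34, 38), (22, 38), (36, 38), (37, 38), (33, 39), (33, 40), (39, 40), (35, 39), (32, 40), (35, 41), (32, 41), (39, 41), (40, 41), (42, 45), (42, 46), (45, 46), (44, 47), (44, 48), (47, 48), (45, 47), (43, 48), (45, 49), (43, 49), (47, 49), (48, 49), (44, 50), (44, 51), (50, 51), (46, 50), (1, 51), (46, 52), (1, 52), (50, 52), (51, 52), (42, 54), (42, 55), (54, 55), (53, 56), (53, 57), (56, 57), (54, 56), (43, 57), (54, 58), (43, 58), (56, 58), (57, 58), (53, 59), (53, 60), (59, 60), (55, 59), (32, 60), (55, 61), (32, 61), (59, 61), (60, 61)]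

def wt (k : ℕ) : ℤ := if k < 61 then 1 else 0
def lpp (k : ℕ) : ℤ := if k < 61 then 0 else 1
def lu (k : ℕ) : ℕ := if k = 62 then 1 else if k = 63 then 3 else if k = 64 then 42 else 0
def lm (k : ℕ) : ℤ := if k = 26 ∨ k = 35 ∨ k = 64 then 1 else 0
def lv (k : ℕ) : ℕ := if k = 64 then 44 else 64
def lc (k : ℕ) : ℤ := if k < 61 then (if k = 26 ∨ k = 35 then 0 else -1) else 0

def dl (j a : ℕ) : ℤ := if j = a then 1 else 0

def Ji (k j : ℕ) : ℤ :=
  wt k * (2 * (Y0 (2 * ea k) - Y0 (2 * eb k)) * (dl j (2 * ea k) - dl j (2 * eb k))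
    + 2 * (Y0 (2 * ea k + 1) - Y0 (2 * eb k + 1)) * (dl j (2 * ea k + 1) - dl j (2 * eb k + 1)))
  + 1000000 * (lpp k * dl j (lu k) - lm k * dl j (lv k))

def Fi (k : ℕ) : ℤ :=
  wt k * ((Y0 (2 * ea k) - Y0 (2 * eb k)) ^ 2 + (Y0 (2 * ea k + 1) - Y0 (2 * eb k + 1)) ^ 2)
  + 1000000 * (lpp k * Y0 (lu k) - lm k * Y0 (lv k)) + 1000000000000 * lc k

def Bd (R k : ℕ) : ℤ := (dec R 10 k : ℤ) - 512
def Bi (i k : ℕ) : ℤ := Bd (Brows.getD i 0) k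

def col (j : ℕ) : List (ℕ × ℤ) := colsD.getD j []

def rowEnt (i j : ℕ) : ℤ :=
  256000000 * dl i j - ((col j).map (fun p => Bi i p.1 * p.2)).sum

theorem chkF : ∀ k < 65, Fi k = F0l.getD k 0 := by decide +kernel
theorem chkJ : ∀ k < 65, ∀ j < 65,
    Ji k j = ((col j).map (fun p => if p.1 = k then p.2 else 0)).sum := by decide +kernel
theorem chkC : ∀ j < 65, ∀ p ∈ col j, p.1 < 65 := by decide +kernel
theorem chkB1 : ∀ i < 65, ((List.range 65).map (fun k => (Bi i k).natAbs)).sum ≤ 5120 := by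
  decide +kernel
theorem chkB2 : ∀ i < 65,
    (((List.range 65).map (fun k => Bi i k * F0l.getD k 0)).sum).natAbs ≤ 512000000 := by
  decide +kernel
theorem chkB3 : ∀ i < 65,
    ((List.range 65).map (fun j => (rowEnt i j).natAbs)).sum ≤ 51200000 := by
  decide +kernel

def ix (n : ℕ) : Fin 65 := Fin.ofNat 65 n

noncomputable def Fr (y : Fin 65 → ℝ) (k : Fin 65) : ℝ :=
  (wt k : ℝ) * ((y (ix (2 * ea k)) - y (ix (2 * eb k))) ^ 2
    + (y (ix (2 * ea k + 1)) - y (ix (2 * eb k + 1))) ^ 2)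
  + ((lpp k : ℝ) * y (ix (lu k)) - (lm k : ℝ) * y (ix (lv k))) + (lc k : ℝ)

noncomputable def dr (j a : Fin 65) : ℝ := if j = a then 1 else 0

noncomputable def Jr (z : Fin 65 → ℝ) : Matrix (Fin 65) (Fin 65) ℝ := fun k j =>
  (wt k : ℝ) * (2 * (z (ix (2 * ea k)) - z (ix (2 * eb k)))
      * (dr j (ix (2 * ea k)) - dr j (ix (2 * eb k)))
    + 2 * (z (ix (2 * ea k + 1)) - z (ix (2 * eb k + 1)))
      * (dr j (ix (2 * ea k + 1)) - dr j (ix (2 * eb k + 1))))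
  + ((lpp k : ℝ) * dr j (ix (lu k)) - (lm k : ℝ) * dr j (ix (lv k)))

theorem sum_dr (a : Fin 65) (v : Fin 65 → ℝ) : ∑ j, dr j a * v j = v a := by
  simp [dr]

theorem sum_dr1 (a : Fin 65) : ∑ j, dr j a = 1 := by
  simp [dr]

theorem dr_nonneg (j a : Fin 65) : 0 ≤ dr j a := by
  unfold dr; split_ifs <;> norm_num

theorem sum_lin (a b c d e : ℝ) (i1 i2 i3 i4 i5 i6 : Fin 65) (v : Fin 65 → ℝ) :
    ∑ j, (a * (b * (dr j i1 - dr j i2) + c * (dr j i3 - dr j i4)) + (d * dr j i5 - e * dr j i6)) * v j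
    = a * (b * (v i1 - v i2) + c * (v i3 - v i4)) + (d * v i5 - e * v i6) := by
  rw [← sum_dr i1 v, ← sum_dr i2 v, ← sum_dr i3 v, ← sum_dr i4 v, ← sum_dr i5 v, ← sum_dr i6 v]
  simp only [← Finset.sum_sub_distrib, ← Finset.sum_add_distrib, Finset.mul_sum]
  apply Finset.sum_congr rfl
  intro j _
  ring

theorem Fr_diff (x y : Fin 65 → ℝ) :
    Fr x - Fr y = (Jr ((1/2 : ℝ) • (x + y))).mulVec (x - y) := by
  funext k
  rw [Matrix.mulVec, dotProduct]
  simp only [Jr]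
  rw [sum_lin]
  simp only [Fr, Pi.sub_apply, Pi.smul_apply, Pi.add_apply, smul_eq_mul]
  ring

noncomputable def y0 (j : Fin 65) : ℝ := (Y0 j : ℝ) / 1000000
noncomputable def Br : Matrix (Fin 65) (Fin 65) ℝ := fun i k => (Bi i k : ℝ) / 256

theorem ix_val (n : ℕ) (h : n < 65) : ((ix n : Fin 65) : ℕ) = n := by
  simp [ix, Fin.ofNat, Nat.mod_eq_of_lt h]

theorem chkI : ∀ k < 65, 2 * ea k + 1 < 65 ∧ 2 * eb k + 1 < 65 ∧ lu k < 65 ∧ lv k < 65 := by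
  decide +kernel

theorem dr_cast (j : Fin 65) (a : ℕ) (h : a < 65) : dr j (ix a) = (dl j a : ℝ) := by
  unfold dr dl
  have : j = ix a ↔ (j : ℕ) = a := by rw [Fin.ext_iff, ix_val a h]
  simp only [this]; split_ifs <;> simp

theorem y0_ix (a : ℕ) (h : a < 65) : y0 (ix a) = (Y0 a : ℝ) / 1000000 := by
  rw [y0, ix_val a h]

theorem Jr_y0 (k j : Fin 65) : Jr y0 k j = (Ji k j : ℝ) / 1000000 := by
  obtain ⟨h1, h2, h3, h4⟩ := chkI k k.2
  simp only [Jr, Ji]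
  rw [y0_ix _ h1, y0_ix _ h2, y0_ix _ (by omega), y0_ix _ (by omega), dr_cast _ _ h1,
    dr_cast _ _ h2, dr_cast _ _ h3, dr_cast _ _ h4, dr_cast _ _ (by omega), dr_cast _ _ (by omega)]
  push_cast
  ring

theorem Fr_y0 (k : Fin 65) : Fr y0 k = (Fi k : ℝ) / 1000000000000 := by
  obtain ⟨h1, h2, h3, h4⟩ := chkI k k.2
  simp only [Fr, Fi]
  rw [y0_ix _ h1, y0_ix _ h2, y0_ix _ (by omega), y0_ix _ (by omega), y0_ix _ h3, y0_ix _ h4]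
  push_cast
  ring

theorem list_sum_range {M : Type*} [AddCommMonoid M] (f : ℕ → M) (n : ℕ) :
    ((List.range n).map f).sum = ∑ i : Fin n, f i := by
  rw [← Finset.sum_range]
  induction n with
  | zero => simp
  | succ n ih => rw [List.range_succ, Finset.sum_range_succ]; simp [ih]

theorem colsum (b : ℕ → ℤ) (l : List (ℕ × ℤ)) (hl : ∀ p ∈ l, p.1 < 65) :
    ∑ k : Fin 65, b k * (l.map (fun p => if p.1 = (k : ℕ) then p.2 else 0)).sum
      = (l.map (fun p => b p.1 * p.2)).sum := by
  induction l with
  | nil => simp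
  | cons p l ih =>
    have h1 : p.1 < 65 := hl p (by simp)
    simp only [List.map_cons, List.sum_cons, mul_add, Finset.sum_add_distrib]
    rw [ih (fun q hq => hl q (by simp [hq]))]
    congr 1
    rw [Finset.sum_eq_single (⟨p.1, h1⟩ : Fin 65)]
    · simp
    · intro k _ hk
      have : ¬ p.1 = (k : ℕ) := fun h => hk (by ext; exact h.symm)
      simp [this]
    · simp

theorem BJ (i j : Fin 65) : (1 - Br * Jr y0) i j = (rowEnt i j : ℝ) / 256000000 := by
  have h : (Br * Jr y0) i j = ((∑ k : Fin 65, Bi i k * Ji k j : ℤ) : ℝ) / 256000000 := by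
    rw [Matrix.mul_apply]
    push_cast
    rw [Finset.sum_div]
    apply Finset.sum_congr rfl
    intro k _
    rw [Jr_y0, Br]; ring
  have h2 : (∑ k : Fin 65, Bi i k * Ji k j : ℤ)
      = ((col j).map (fun p => Bi i p.1 * p.2)).sum := by
    rw [← colsum (Bi i) (col j) (chkC j j.2)]
    apply Finset.sum_congr rfl
    intro k _
    rw [chkJ k k.2 j j.2]
  rw [Matrix.sub_apply, h, h2, rowEnt, Matrix.one_apply, dl]
  simp only [Fin.ext_iff]
  push_cast
  split_ifs <;> ring

theorem abs_row (i : Fin 65) : ∑ j, |(1 - Br * Jr y0) i j| ≤ 1/5 := by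
  have h := chkB3 i i.2
  rw [list_sum_range] at h
  have h' : ((∑ j : Fin 65, (rowEnt i j).natAbs : ℕ) : ℝ) ≤ 51200000 := by exact_mod_cast h
  simp only [BJ, abs_div]
  rw [← Finset.sum_div]
  push_cast [Nat.cast_natAbs] at h'
  rw [show |(256000000:ℝ)| = 256000000 by norm_num]
  rw [div_le_iff₀ (by norm_num)]
  linarith

theorem abs_B (i : Fin 65) : ∑ k, |Br i k| ≤ 20 := by
  have h := chkB1 i i.2
  rw [list_sum_range] at h
  have h' : ((∑ k : Fin 65, (Bi i k).natAbs : ℕ) : ℝ) ≤ 5120 := by exact_mod_cast h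
  simp only [Br, abs_div]
  rw [← Finset.sum_div]
  push_cast [Nat.cast_natAbs] at h'
  rw [show |(256:ℝ)| = 256 by norm_num]
  rw [div_le_iff₀ (by norm_num)]
  linarith

theorem BF (i : Fin 65) : |(Br.mulVec (Fr y0)) i| ≤ (1/250000) / 2 := by
  have h := chkB2 i i.2
  rw [list_sum_range] at h
  have e : (Br.mulVec (Fr y0)) i
      = ((∑ k : Fin 65, Bi i k * F0l.getD k 0 : ℤ) : ℝ) / 256000000000000 := by
    rw [Matrix.mulVec, dotProduct]
    push_cast
    rw [Finset.sum_div]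
    apply Finset.sum_congr rfl
    intro k _
    rw [Fr_y0, Br, chkF k k.2]; ring
  have h' : |((∑ k : Fin 65, Bi i k * F0l.getD k 0 : ℤ) : ℝ)| ≤ 512000000 := by
    rw [← Int.cast_abs, Int.abs_eq_natAbs]
    exact_mod_cast h
  rw [e, abs_div, show |(256000000000000:ℝ)| = 256000000000000 by norm_num,
    div_le_iff₀ (by norm_num)]
  linarith

theorem Jr_diff (z : Fin 65 → ℝ) (hz : ‖z - y0‖ ≤ 1/250000) (k : Fin 65) :
    ∑ j, |Jr z k j - Jr y0 k j| ≤ 16 / 250000 := by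
  have hc : ∀ a, |z a - y0 a| ≤ 1/250000 := fun a => (norm_le_pi_norm (z - y0) a).trans hz
  have hw : |(wt k : ℝ)| ≤ 1 := by
    unfold wt; split_ifs <;> simp
  set i1 := ix (2 * ea k)
  set i2 := ix (2 * eb k)
  set i3 := ix (2 * ea k + 1)
  set i4 := ix (2 * eb k + 1)
  have hb : ∀ j, |Jr z k j - Jr y0 k j| ≤ 4/250000 * (dr j i1 + dr j i2 + dr j i3 + dr j i4) := by
    intro j
    have e : Jr z k j - Jr y0 k j = (wt k : ℝ) *
        (2 * ((z i1 - y0 i1) - (z i2 - y0 i2)) * (dr j i1 - dr j i2)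
          + 2 * ((z i3 - y0 i3) - (z i4 - y0 i4)) * (dr j i3 - dr j i4)) := by
      simp only [Jr, i1, i2, i3, i4]; ring
    have key : ∀ a b : Fin 65, |2 * ((z a - y0 a) - (z b - y0 b)) * (dr j a - dr j b)|
        ≤ 4/250000 * (dr j a + dr j b) := by
      intro a b
      rw [abs_mul]
      apply mul_le_mul
      · have h1 := abs_le.1 (hc a)
        have h2 := abs_le.1 (hc b)
        rw [abs_le]; constructor <;> linarith [h1.1, h1.2, h2.1, h2.2]
      · have h1 := dr_nonneg j a
        have h2 := dr_nonneg j b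
        rw [abs_le]; constructor <;> linarith
      · positivity
      · norm_num
    rw [e, abs_mul]
    have h3 := abs_add_le (2 * ((z i1 - y0 i1) - (z i2 - y0 i2)) * (dr j i1 - dr j i2))
      (2 * ((z i3 - y0 i3) - (z i4 - y0 i4)) * (dr j i3 - dr j i4))
    have h4 := key i1 i2
    have h5 := key i3 i4
    calc _ ≤ 1 * |2 * ((z i1 - y0 i1) - (z i2 - y0 i2)) * (dr j i1 - dr j i2)
          + 2 * ((z i3 - y0 i3) - (z i4 - y0 i4)) * (dr j i3 - dr j i4)| :=
          mul_le_mul_of_nonneg_right hw (abs_nonneg _)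
      _ ≤ _ := by linarith
  calc _ ≤ ∑ j, 4/250000 * (dr j i1 + dr j i2 + dr j i3 + dr j i4) :=
        Finset.sum_le_sum (fun j _ => hb j)
    _ = _ := by
        rw [← Finset.mul_sum]
        simp only [Finset.sum_add_distrib, sum_dr1]
        norm_num

theorem row_z (z : Fin 65 → ℝ) (hz : ‖z - y0‖ ≤ 1/250000) (i : Fin 65) :
    ∑ j, |(1 - Br * Jr z) i j| ≤ 1/2 := by
  have e : ∀ j, |(1 - Br * Jr z) i j| ≤ |(1 - Br * Jr y0) i j|
      + ∑ k, |Br i k| * |Jr z k j - Jr y0 k j| := by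
    intro j
    have : (1 - Br * Jr z) i j = (1 - Br * Jr y0) i j - ∑ k, Br i k * (Jr z k j - Jr y0 k j) := by
      simp only [Matrix.sub_apply, Matrix.mul_apply, mul_sub, Finset.sum_sub_distrib]
      ring
    rw [this]
    refine (abs_sub _ _).trans ?_
    gcongr
    refine (Finset.abs_sum_le_sum_abs _ _).trans (le_of_eq ?_)
    simp only [abs_mul]
  calc _ ≤ ∑ j, (|(1 - Br * Jr y0) i j| + ∑ k, |Br i k| * |Jr z k j - Jr y0 k j|) :=
        Finset.sum_le_sum (fun j _ => e j)
    _ = ∑ j, |(1 - Br * Jr y0) i j| + ∑ k, |Br i k| * ∑ j, |Jr z k j - Jr y0 k j| := by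
        rw [Finset.sum_add_distrib, Finset.sum_comm]
        simp only [Finset.mul_sum]
    _ ≤ 1/5 + ∑ k, |Br i k| * (16/250000) := by
        refine add_le_add (abs_row i) (Finset.sum_le_sum (fun k _ => ?_))
        exact mul_le_mul_of_nonneg_left (Jr_diff z hz k) (abs_nonneg _)
    _ ≤ _ := by
        rw [← Finset.sum_mul]
        have := abs_B i
        linarith

theorem exists_sol : ∃ y : Fin 65 → ℝ, (∀ j, |y j - y0 j| ≤ 1/250000) ∧ ∀ k, Fr y k = 0 := by
  obtain ⟨y, h1, h2⟩ := newton_aux Fr Jr Fr_diff Br y0 (1/250000) (by norm_num)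
    (fun z hz i => row_z z hz i) BF
  exact ⟨y, fun j => (norm_le_pi_norm (y - y0) j).trans h1, fun k => by rw [h2]; rfl⟩

abbrev E2 := EuclideanSpace ℝ (Fin 2)

theorem seg_coord {p q x : E2} (h : x ∈ segment ℝ p q) :
    ∃ t : ℝ, 0 ≤ t ∧ t ≤ 1 ∧ ∀ i, x i = p i + t * (q i - p i) := by
  obtain ⟨a, b, ha, hb, hab, rfl⟩ := h
  refine ⟨b, hb, by linarith, fun i => ?_⟩
  have : a = 1 - b := by linarith
  subst this
  simp only [PiLp.add_apply, PiLp.smul_apply, smul_eq_mul]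
  ring

theorem sep_lemma {p q r s x : E2} (α β γ : ℝ) (hp : α * p 0 + β * p 1 ≤ γ)
    (hq : α * q 0 + β * q 1 ≤ γ) (hr : γ < α * r 0 + β * r 1) (hs : γ < α * s 0 + β * s 1)
    (h1 : x ∈ segment ℝ p q) (h2 : x ∈ segment ℝ r s) : False := by
  obtain ⟨t, t0, t1, ht⟩ := seg_coord h1
  obtain ⟨u, u0, u1, hu⟩ := seg_coord h2
  have a1 : α * x 0 + β * x 1 = (1 - t) * (α * p 0 + β * p 1) + t * (α * q 0 + β * q 1) := by
    rw [ht 0, ht 1]; ring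
  have a2 : α * x 0 + β * x 1 = (1 - u) * (α * r 0 + β * r 1) + u * (α * s 0 + β * s 1) := by
    rw [hu 0, hu 1]; ring
  have b1 : α * x 0 + β * x 1 ≤ γ := by
    rw [a1]; nlinarith [mul_le_mul_of_nonneg_left hp (sub_nonneg.2 t1), mul_le_mul_of_nonneg_left hq t0]
  have b2 : γ < α * x 0 + β * x 1 := by
    rw [a2]
    rcases u0.eq_or_lt with h | h
    · rw [← h]; linarith
    · nlinarith [mul_le_mul_of_nonneg_left hr.le (sub_nonneg.2 u1), mul_lt_mul_of_pos_left hs h]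
  linarith

theorem share_lemma {v a b x : E2}
    (h : (a 0 - v 0) * (b 1 - v 1) - (a 1 - v 1) * (b 0 - v 0) ≠ 0 ∨
      (a 0 - v 0) * (b 0 - v 0) + (a 1 - v 1) * (b 1 - v 1) < 0)
    (h1 : x ∈ segment ℝ v a) (h2 : x ∈ segment ℝ v b) : x = v := by
  obtain ⟨t, t0, t1, ht⟩ := seg_coord h1
  obtain ⟨u, u0, u1, hu⟩ := seg_coord h2
  have e0 : t * (a 0 - v 0) = u * (b 0 - v 0) := by linarith [ht 0, hu 0]
  have e1 : t * (a 1 - v 1) = u * (b 1 - v 1) := by linarith [ht 1, hu 1]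
  have hz : t * (a 0 - v 0) = 0 ∧ t * (a 1 - v 1) = 0 := by
    rcases h with h | h
    · have : t * ((a 0 - v 0) * (b 1 - v 1) - (a 1 - v 1) * (b 0 - v 0)) = 0 := by
        linear_combination (b 1 - v 1) * e0 - (b 0 - v 0) * e1
      rcases mul_eq_zero.1 this with h' | h'
      · simp [h']
      · exact absurd h' h
    · have e : (t * (a 0 - v 0)) ^ 2 + (t * (a 1 - v 1)) ^ 2
          = t * u * ((a 0 - v 0) * (b 0 - v 0) + (a 1 - v 1) * (b 1 - v 1)) := by
        linear_combination t * (a 0 - v 0) * e0 + t * (a 1 - v 1) * e1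
      have le : t * u * ((a 0 - v 0) * (b 0 - v 0) + (a 1 - v 1) * (b 1 - v 1)) ≤ 0 :=
        mul_nonpos_of_nonneg_of_nonpos (mul_nonneg t0 u0) h.le
      constructor <;> nlinarith [sq_nonneg (t * (a 0 - v 0)), sq_nonneg (t * (a 1 - v 1))]
  ext i
  fin_cases i
  · have := ht 0; simp only [Fin.zero_eta]; linarith [hz.1]
  · have := ht 1; simp only [Fin.mk_one]; linarith [hz.2]

def crI (v a b : ℕ) : ℤ := (PX a - PX v) * (PY b - PY v) - (PY a - PY v) * (PX b - PX v)
def dotI (v a b : ℕ) : ℤ := (PX a - PX v) * (PX b - PX v) + (PY a - PY v) * (PY b - PY v)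
def tolI (v a b : ℕ) : ℤ :=
  200 * ((PX a - PX v).natAbs + (PY a - PY v).natAbs + (PX b - PX v).natAbs + (PY b - PY v).natAbs)
    + 80000

def sepI (Z : ℕ → ℤ) (e f : ℕ × ℕ) : Prop :=
  Z e.1 + 200 < Z f.1 ∧ Z e.1 + 200 < Z f.2 ∧ Z e.2 + 200 < Z f.1 ∧ Z e.2 + 200 < Z f.2
instance (Z : ℕ → ℤ) (e f : ℕ × ℕ) : Decidable (sepI Z e f) := by unfold sepI; infer_instance

def sideI (e f : ℕ × ℕ) : Prop :=
  (tolI e.1 e.2 f.1 < crI e.1 e.2 f.1 ∧ tolI e.1 e.2 f.2 < crI e.1 e.2 f.2) ∨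
  (crI e.1 e.2 f.1 < - tolI e.1 e.2 f.1 ∧ crI e.1 e.2 f.2 < - tolI e.1 e.2 f.2)
instance (e f : ℕ × ℕ) : Decidable (sideI e f) := by unfold sideI; infer_instance

def shI (v a b : ℕ) : Prop :=
  tolI v a b < crI v a b ∨ crI v a b < - tolI v a b ∨ dotI v a b < - tolI v a b
instance (v a b : ℕ) : Decidable (shI v a b) := by unfold shI; infer_instance

def okp (e f : ℕ × ℕ) : Prop :=
  sepI PX e f ∨ sepI PX f e ∨ sepI PY e f ∨ sepI PY f e ∨
  (e.1 = f.1 ∧ shI e.1 e.2 f.2) ∨ (e.1 = f.2 ∧ shI e.1 e.2 f.1) ∨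
  (e.2 = f.1 ∧ shI e.2 e.1 f.2) ∨ (e.2 = f.2 ∧ shI e.2 e.1 f.1) ∨
  sideI e f ∨ sideI f e
instance (e f : ℕ × ℕ) : Decidable (okp e f) := by unfold okp; infer_instance

theorem chkP : EN.Pairwise okp := by decide +kernel
theorem chkN : EN.Nodup := by decide +kernel
theorem chkLt : ∀ e ∈ EN, e.1 < e.2 ∧ e.2 < 62 := by decide +kernel
theorem chkInj : ∀ v < 62, ∀ w < v,
    200 < (PX v - PX w).natAbs ∨ 200 < (PY v - PY w).natAbs := by decide +kernel
theorem chkDeg : ∀ v < 62, (EN.filter (fun e => e.1 = v ∨ e.2 = v)).length = 4 := by decide +kernel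
theorem chkEx : (EN.filter (fun e => ¬ (e = (9, 19) ∨ e = (13, 17)))).length = 122 := by
  decide +kernel

theorem prod_err {A B a b : ℝ} (h1 : |A - a| ≤ 200) (h2 : |B - b| ≤ 200) :
    |A * B - a * b| ≤ 200 * (|a| + |b|) + 40000 := by
  have : A * B - a * b = (A - a) * (B - b) + a * (B - b) + (A - a) * b := by ring
  rw [this]
  have h3 : |(A - a) * (B - b)| ≤ 200 * 200 := by
    rw [abs_mul]; exact mul_le_mul h1 h2 (abs_nonneg _) (by norm_num)
  have h4 : |a * (B - b)| ≤ |a| * 200 := by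
    rw [abs_mul]; exact mul_le_mul_of_nonneg_left h2 (abs_nonneg _)
  have h5 : |(A - a) * b| ≤ 200 * |b| := by
    rw [abs_mul]; exact mul_le_mul_of_nonneg_right h1 (abs_nonneg _)
  have h6 := abs_add_le ((A - a) * (B - b) + a * (B - b)) ((A - a) * b)
  have h7 := abs_add_le ((A - a) * (B - b)) (a * (B - b))
  linarith

section
variable (X Y : ℕ → ℝ) (hX : ∀ v < 62, |1000000 * X v - PX v| ≤ 100)
  (hY : ∀ v < 62, |1000000 * Y v - PY v| ≤ 100)
include hX hY

theorem diff_err {Z : ℕ → ℝ} {Q : ℕ → ℤ} (h : ∀ v < 62, |1000000 * Z v - Q v| ≤ 100) {a v : ℕ}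
    (ha : a < 62) (hv : v < 62) :
    |1000000 * (Z a - Z v) - ((Q a - Q v : ℤ) : ℝ)| ≤ 200 := by
  have h1 := abs_le.1 (h a ha)
  have h2 := abs_le.1 (h v hv)
  push_cast
  rw [abs_le]; constructor <;> linarith [h1.1, h1.2, h2.1, h2.2]

theorem cr_err {v a b : ℕ} (hv : v < 62) (ha : a < 62) (hb : b < 62) :
    |1000000000000 * ((X a - X v) * (Y b - Y v) - (Y a - Y v) * (X b - X v)) - (crI v a b : ℝ)|
      ≤ (tolI v a b : ℝ) := by
  have h1 := prod_err (diff_err X Y hX hY hX ha hv) (diff_err X Y hX hY hY hb hv)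
  have h2 := prod_err (diff_err X Y hX hY hY ha hv) (diff_err X Y hX hY hX hb hv)
  have h1' := abs_le.1 h1
  have h2' := abs_le.1 h2
  unfold crI tolI
  push_cast [Nat.cast_natAbs] at *
  rw [abs_le]; constructor <;> linarith [h1'.1, h1'.2, h2'.1, h2'.2]

theorem dot_err {v a b : ℕ} (hv : v < 62) (ha : a < 62) (hb : b < 62) :
    |1000000000000 * ((X a - X v) * (X b - X v) + (Y a - Y v) * (Y b - Y v)) - (dotI v a b : ℝ)|
      ≤ (tolI v a b : ℝ) := by
  have h1 := prod_err (diff_err X Y hX hY hX ha hv) (diff_err X Y hX hY hX hb hv)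
  have h2 := prod_err (diff_err X Y hX hY hY ha hv) (diff_err X Y hX hY hY hb hv)
  have h1' := abs_le.1 h1
  have h2' := abs_le.1 h2
  unfold dotI tolI
  push_cast [Nat.cast_natAbs] at *
  rw [abs_le]; constructor <;> linarith [h1'.1, h1'.2, h2'.1, h2'.2]

theorem sh_ok {v a b : ℕ} (hv : v < 62) (ha : a < 62) (hb : b < 62) (h : shI v a b)
    {x : E2} (h1 : x ∈ segment ℝ (!₂[X v, Y v] : E2) !₂[X a, Y a])
    (h2 : x ∈ segment ℝ (!₂[X v, Y v] : E2) !₂[X b, Y b]) : x = !₂[X v, Y v] := by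
  refine share_lemma ?_ h1 h2
  have c := abs_le.1 (cr_err X Y hX hY hv ha hb)
  have d := abs_le.1 (dot_err X Y hX hY hv ha hb)
  simp only [Matrix.cons_val_zero, Matrix.cons_val_one]
  rcases h with h | h | h
  · have : (tolI v a b : ℝ) < crI v a b := by exact_mod_cast h
    left; apply ne_of_gt; linarith [c.1]
  · have : (crI v a b : ℝ) < - tolI v a b := by exact_mod_cast h
    left; apply ne_of_lt; linarith [c.2]
  · have : (dotI v a b : ℝ) < - tolI v a b := by exact_mod_cast h
    right; linarith [d.2]

theorem sep_okX {e f : ℕ × ℕ} (h11 : e.1 < 62) (h12 : e.2 < 62) (h21 : f.1 < 62) (h22 : f.2 < 62)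
    (h : sepI PX e f) {x : E2} (h1 : x ∈ segment ℝ (!₂[X e.1, Y e.1] : E2) !₂[X e.2, Y e.2])
    (h2 : x ∈ segment ℝ (!₂[X f.1, Y f.1] : E2) !₂[X f.2, Y f.2]) : False := by
  obtain ⟨a, b, c, d⟩ := h
  have a' : (PX e.1 : ℝ) + 200 < PX f.1 := by exact_mod_cast a
  have b' : (PX e.1 : ℝ) + 200 < PX f.2 := by exact_mod_cast b
  have c' : (PX e.2 : ℝ) + 200 < PX f.1 := by exact_mod_cast c
  have d' : (PX e.2 : ℝ) + 200 < PX f.2 := by exact_mod_cast d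
  have i1 := abs_le.1 (hX _ h11)
  have i2 := abs_le.1 (hX _ h12)
  have i3 := abs_le.1 (hX _ h21)
  have i4 := abs_le.1 (hX _ h22)
  refine sep_lemma 1 0 (max (X e.1) (X e.2)) ?_ ?_ ?_ ?_ h1 h2 <;>
    simp only [Matrix.cons_val_zero, Matrix.cons_val_one, one_mul, zero_mul, add_zero]
  · exact le_max_left _ _
  · exact le_max_right _ _
  · apply max_lt <;> linarith [i1.2, i2.2, i3.1, i4.1]
  · apply max_lt <;> linarith [i1.2, i2.2, i3.1, i4.1]

theorem sep_okY {e f : ℕ × ℕ} (h11 : e.1 < 62) (h12 : e.2 < 62) (h21 : f.1 < 62) (h22 : f.2 < 62)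
    (h : sepI PY e f) {x : E2} (h1 : x ∈ segment ℝ (!₂[X e.1, Y e.1] : E2) !₂[X e.2, Y e.2])
    (h2 : x ∈ segment ℝ (!₂[X f.1, Y f.1] : E2) !₂[X f.2, Y f.2]) : False := by
  obtain ⟨a, b, c, d⟩ := h
  have a' : (PY e.1 : ℝ) + 200 < PY f.1 := by exact_mod_cast a
  have b' : (PY e.1 : ℝ) + 200 < PY f.2 := by exact_mod_cast b
  have c' : (PY e.2 : ℝ) + 200 < PY f.1 := by exact_mod_cast c
  have d' : (PY e.2 : ℝ) + 200 < PY f.2 := by exact_mod_cast d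
  have i1 := abs_le.1 (hY _ h11)
  have i2 := abs_le.1 (hY _ h12)
  have i3 := abs_le.1 (hY _ h21)
  have i4 := abs_le.1 (hY _ h22)
  refine sep_lemma 0 1 (max (Y e.1) (Y e.2)) ?_ ?_ ?_ ?_ h1 h2 <;>
    simp only [Matrix.cons_val_zero, Matrix.cons_val_one, one_mul, zero_mul, zero_add]
  · exact le_max_left _ _
  · exact le_max_right _ _
  · apply max_lt <;> linarith [i1.2, i2.2, i3.1, i4.1]
  · apply max_lt <;> linarith [i1.2, i2.2, i3.1, i4.1]

theorem side_ok {e f : ℕ × ℕ} (h11 : e.1 < 62) (h12 : e.2 < 62) (h21 : f.1 < 62) (h22 : f.2 < 62)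
    (h : sideI e f) {x : E2} (h1 : x ∈ segment ℝ (!₂[X e.1, Y e.1] : E2) !₂[X e.2, Y e.2])
    (h2 : x ∈ segment ℝ (!₂[X f.1, Y f.1] : E2) !₂[X f.2, Y f.2]) : False := by
  have c1 := abs_le.1 (cr_err X Y hX hY h11 h12 h21)
  have c2 := abs_le.1 (cr_err X Y hX hY h11 h12 h22)
  set α := Y e.2 - Y e.1 with hα
  set β := X e.2 - X e.1 with hβ
  rcases h with ⟨a, b⟩ | ⟨a, b⟩
  · have a' : (tolI e.1 e.2 f.1 : ℝ) < crI e.1 e.2 f.1 := by exact_mod_cast a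
    have b' : (tolI e.1 e.2 f.2 : ℝ) < crI e.1 e.2 f.2 := by exact_mod_cast b
    refine sep_lemma (-α) β (-α * X e.1 + β * Y e.1) ?_ ?_ ?_ ?_ h1 h2 <;>
      simp only [Matrix.cons_val_zero, Matrix.cons_val_one]
    · exact le_refl _
    · rw [hα, hβ]; apply le_of_eq; ring
    · linarith [c1.1]
    · linarith [c2.1]
  · have a' : (crI e.1 e.2 f.1 : ℝ) < - tolI e.1 e.2 f.1 := by exact_mod_cast a
    have b' : (crI e.1 e.2 f.2 : ℝ) < - tolI e.1 e.2 f.2 := by exact_mod_cast b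
    refine sep_lemma α (-β) (α * X e.1 + -β * Y e.1) ?_ ?_ ?_ ?_ h1 h2 <;>
      simp only [Matrix.cons_val_zero, Matrix.cons_val_one]
    · exact le_refl _
    · rw [hα, hβ]; apply le_of_eq; ring
    · linarith [c1.2]
    · linarith [c2.2]

theorem pair_ok {e f : ℕ × ℕ} (h11 : e.1 < 62) (h12 : e.2 < 62) (h21 : f.1 < 62) (h22 : f.2 < 62)
    (h : okp e f) (x : E2) (h1 : x ∈ segment ℝ (!₂[X e.1, Y e.1] : E2) !₂[X e.2, Y e.2])
    (h2 : x ∈ segment ℝ (!₂[X f.1, Y f.1] : E2) !₂[X f.2, Y f.2]) :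
    (x = !₂[X e.1, Y e.1] ∨ x = !₂[X e.2, Y e.2]) ∧
      (x = !₂[X f.1, Y f.1] ∨ x = !₂[X f.2, Y f.2]) := by
  have h1' := h1
  have h2' := h2
  rw [segment_symm] at h1' h2'
  rcases h with h | h | h | h | ⟨g, h⟩ | ⟨g, h⟩ | ⟨g, h⟩ | ⟨g, h⟩ | h | h
  · exact (sep_okX X Y hX hY h11 h12 h21 h22 h h1 h2).elim
  · exact (sep_okX X Y hX hY h21 h22 h11 h12 h h2 h1).elim
  · exact (sep_okY X Y hX hY h11 h12 h21 h22 h h1 h2).elim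
  · exact (sep_okY X Y hX hY h21 h22 h11 h12 h h2 h1).elim
  · rw [← g] at h2
    have := sh_ok X Y hX hY h11 h12 h22 h h1 h2
    exact ⟨Or.inl this, Or.inl (g ▸ this)⟩
  · rw [← g] at h2'
    have := sh_ok X Y hX hY h11 h12 h21 h h1 h2'
    exact ⟨Or.inl this, Or.inr (g ▸ this)⟩
  · rw [← g] at h2
    have := sh_ok X Y hX hY h12 h11 h22 h h1' h2
    exact ⟨Or.inr this, Or.inl (g ▸ this)⟩
  · rw [← g] at h2'
    have := sh_ok X Y hX hY h12 h11 h21 h h1' h2'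
    exact ⟨Or.inr this, Or.inr (g ▸ this)⟩
  · exact (side_ok X Y hX hY h11 h12 h21 h22 h h1 h2).elim
  · exact (side_ok X Y hX hY h21 h22 h11 h12 h h2 h1).elim

theorem noncross {e f : ℕ × ℕ} (he : e ∈ EN) (hf : f ∈ EN) (hef : e ≠ f) :
    ∀ x ∈ segment ℝ (!₂[X e.1, Y e.1] : E2) !₂[X e.2, Y e.2] ∩
        segment ℝ (!₂[X f.1, Y f.1] : E2) !₂[X f.2, Y f.2],
    (x = !₂[X e.1, Y e.1] ∨ x = !₂[X e.2, Y e.2]) ∧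
      (x = !₂[X f.1, Y f.1] ∨ x = !₂[X f.2, Y f.2]) := by
  have key : okp e f ∨ okp f e := by
    have hp : EN.Pairwise (fun a b => okp a b ∨ okp b a) := chkP.imp (fun h => Or.inl h)
    have : Std.Symm (fun a b => okp a b ∨ okp b a) := ⟨fun _ _ h => Or.symm h⟩
    exact hp.forall he hf hef
  obtain ⟨a1, a2⟩ := chkLt e he
  obtain ⟨b1, b2⟩ := chkLt f hf
  rintro x ⟨h1, h2⟩
  rcases key with h | h
  · exact pair_ok X Y hX hY (by omega) a2 (by omega) b2 h x h1 h2
  · exact (pair_ok X Y hX hY (by omega) b2 (by omega) a2 h x h2 h1).symm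

theorem pt_inj {v w : ℕ} (hv : v < 62) (hw : w < 62)
    (h : (!₂[X v, Y v] : E2) = !₂[X w, Y w]) : v = w := by
  have hx : X v = X w := by simpa using congrArg (fun p : E2 => p 0) h
  have hy : Y v = Y w := by simpa using congrArg (fun p : E2 => p 1) h
  have ex := diff_err X Y hX hY hX hv hw
  have ey := diff_err X Y hX hY hY hv hw
  rw [hx, sub_self, mul_zero, zero_sub, abs_neg, ← Int.cast_abs, Int.abs_eq_natAbs] at ex
  rw [hy, sub_self, mul_zero, zero_sub, abs_neg, ← Int.cast_abs, Int.abs_eq_natAbs] at ey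
  have ex' : (PX v - PX w).natAbs ≤ 200 := by exact_mod_cast ex
  have ey' : (PY v - PY w).natAbs ≤ 200 := by exact_mod_cast ey
  by_contra hne
  rcases lt_or_gt_of_ne hne with g | g
  · have := chkInj w hw v g; omega
  · have := chkInj v hv w g; omega
end

def EK : List (ℕ × ℕ) := (List.range 40).map (fun k => (0, k)) ++
  ((List.range 84).map (fun m => (1 + m / 21, 40 + m % 21)))

def srt (a b : ℕ) : ℕ × ℕ := if a < b then (a, b) else (b, a)

theorem chkEK : EK.map (fun p => srt (VT p.1 (ea p.2)) (VT p.1 (eb p.2))) = EN := by decide +kernel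

theorem chkEK2 : ∀ p ∈ EK, p.2 < 61 ∧
    ((p.2 = 26 ∨ p.2 = 35) ↔ (srt (VT p.1 (ea p.2)) (VT p.1 (eb p.2)) = (9, 19) ∨
      srt (VT p.1 (ea p.2)) (VT p.1 (eb p.2)) = (13, 17))) := by decide +kernel

def goodV (κ i : ℕ) : Prop :=
  (kd (VT κ i) = κ ∧ bi (VT κ i) = i) ∨
  (i = 0 ∧ κ = 1 ∧ kd (VT κ i) = 0 ∧ bi (VT κ i) = 0) ∨
  (i = 0 ∧ κ = 3 ∧ kd (VT κ i) = 0 ∧ bi (VT κ i) = 1) ∨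
  (i = 0 ∧ κ = 4 ∧ kd (VT κ i) = 2 ∧ bi (VT κ i) = 0) ∨
  ((i = 21 ∨ i = 22) ∧ κ = 2 ∧ kd (VT κ i) = 1 ∧ bi (VT κ i) = i) ∨
  ((i = 21 ∨ i = 22) ∧ κ = 4 ∧ kd (VT κ i) = 3 ∧ bi (VT κ i) = i)
instance (κ i : ℕ) : Decidable (goodV κ i) := by unfold goodV; infer_instance

theorem chkEK3 : ∀ p ∈ EK, goodV p.1 (ea p.2) ∧ goodV p.1 (eb p.2) := by decide +kernel

/-- integer images, scaled by 10^12 -/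
def UI (κ i : ℕ) : ℤ := if κ = 2 ∨ κ = 4 then 2 * Y0 42 - Y0 (2 * i) else Y0 (2 * i)
def XI (κ i : ℕ) : ℤ := if κ = 0 then 1000000 * UI κ i else
  410510 * UI κ i - 911856 * Y0 (2 * i + 1)
def XJ (κ i : ℕ) : ℤ := if 2 < κ then 1000000 * Y0 2 - XI κ i else XI κ i
def YI (κ i : ℕ) : ℤ := if κ = 0 then 1000000 * Y0 (2 * i + 1) else
  911856 * UI κ i + 410510 * Y0 (2 * i + 1)

theorem chkV : ∀ v < 62, bi v < 32 ∧ (UI (kd v) (bi v)).natAbs ≤ 6000000 ∧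
    (Y0 (2 * bi v + 1)).natAbs ≤ 6000000 ∧
    (XJ (kd v) (bi v) - 1000000 * PX v).natAbs ≤ 20000000 ∧
    (YI (kd v) (bi v) - 1000000 * PY v).natAbs ≤ 20000000 := by decide +kernel

theorem chkVals : Y0 2 = 4822150 ∧ Y0 42 = 2936682 ∧ Y0 64 = 962318 := by decide +kernel

structure Sol (bx bv : ℕ → ℝ) (s2 : ℝ) : Prop where
  ax : ∀ i < 32, |1000000 * bx i - Y0 (2 * i)| ≤ 4
  av : ∀ i < 32, |1000000 * bv i - Y0 (2 * i + 1)| ≤ 4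
  as : |1000000 * s2 - 962318| ≤ 4
  hx0 : bx 0 = 0
  hv0 : bv 0 = 0
  hv1 : bv 1 = 0
  hl : bx 22 = bx 21
  hE : ∀ k < 61, (bx (ea k) - bx (eb k)) ^ 2 + (bv (ea k) - bv (eb k)) ^ 2
    = if k = 26 ∨ k = 35 then s2 else 1

theorem exists_Sol : ∃ bx bv s2, Sol bx bv s2 := by
  obtain ⟨y, hy, hF⟩ := exists_sol
  have hap : ∀ n < 65, |1000000 * y (ix n) - Y0 n| ≤ 4 := by
    intro n hn
    have h := abs_le.1 (hy (ix n))
    rw [y0_ix n hn] at h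
    rw [abs_le]; constructor <;> linarith [h.1, h.2]
  refine ⟨fun i => y (ix (2 * i)), fun i => y (ix (2 * i + 1)), y (ix 64), ?_⟩
  constructor
  · intro i hi; exact hap _ (by omega)
  · intro i hi; exact hap _ (by omega)
  · have := hap 64 (by omega)
    rw [chkVals.2.2] at this
    exact_mod_cast this
  · have := hF (ix 61)
    have e : ((ix 61 : Fin 65) : ℕ) = 61 := ix_val _ (by omega)
    simp only [Fr, e] at this
    norm_num [wt, lpp, lm, lu, lv, lc] at this
    exact this
  · have := hF (ix 62)
    have e : ((ix 62 : Fin 65) : ℕ) = 62 := ix_val _ (by omega)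
    simp only [Fr, e] at this
    norm_num [wt, lpp, lm, lu, lv, lc] at this
    exact this
  · have := hF (ix 63)
    have e : ((ix 63 : Fin 65) : ℕ) = 63 := ix_val _ (by omega)
    simp only [Fr, e] at this
    norm_num [wt, lpp, lm, lu, lv, lc] at this
    exact this
  · have := hF (ix 64)
    have e : ((ix 64 : Fin 65) : ℕ) = 64 := ix_val _ (by omega)
    simp only [Fr, e] at this
    norm_num [wt, lpp, lm, lu, lv, lc] at this
    norm_num
    linarith
  · intro k hk
    have := hF (ix k)
    have e : ((ix k : Fin 65) : ℕ) = k := ix_val _ (by omega)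
    simp only [Fr, e] at this
    have h64 : k ≠ 64 := by omega
    by_cases h : k = 26 ∨ k = 35
    · simp only [wt, lpp, lm, lv, lc, hk, h, h64, or_false, if_true, if_false] at this ⊢
      push_cast at this
      linarith
    · simp only [wt, lpp, lm, lv, lc, hk, h, h64, or_false, if_true, if_false] at this ⊢
      push_cast at this
      linarith

section
variable (bx bv : ℕ → ℝ) (q l c s : ℝ)

noncomputable def TU (κ i : ℕ) : ℝ := if κ = 2 ∨ κ = 4 then 2 * l - bx i else bx i
noncomputable def TX0 (κ i : ℕ) : ℝ := if κ = 0 then TU bx l κ i else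
  c * TU bx l κ i - s * bv i
noncomputable def TX (κ i : ℕ) : ℝ :=
  if 2 < κ then q - TX0 bx bv l c s κ i else TX0 bx bv l c s κ i
noncomputable def TY (κ i : ℕ) : ℝ := if κ = 0 then bv i else
  s * TU bx l κ i + c * bv i

theorem T_dist (hcs : c ^ 2 + s ^ 2 = 1) (κ i j : ℕ) :
    (TX bx bv q l c s κ i - TX bx bv q l c s κ j) ^ 2 + (TY bx bv l c s κ i - TY bx bv l c s κ j) ^ 2
      = (bx i - bx j) ^ 2 + (bv i - bv j) ^ 2 := by
  unfold TX TY TX0 TU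
  split_ifs <;> first | omega | ring1 |
    linear_combination ((bx i - bx j) ^ 2 + (bv i - bv j) ^ 2) * hcs
end

theorem main_real {bx bv : ℕ → ℝ} {s2 : ℝ} (h : Sol bx bv s2) :
    ∃ X Y : ℕ → ℝ, (∀ v < 62, |1000000 * X v - PX v| ≤ 100) ∧
      (∀ v < 62, |1000000 * Y v - PY v| ≤ 100) ∧
      ∀ e ∈ EN, (X e.1 - X e.2) ^ 2 + (Y e.1 - Y e.2) ^ 2
        = if e = (9, 19) ∨ e = (13, 17) then s2 else 1 := by
  obtain ⟨v1, v2, -⟩ := chkVals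
  set q := bx 1 with hq
  set l := bx 21 with hl
  have q1 := h.ax 1 (by omega)
  have l1 := h.ax 21 (by omega)
  rw [show 2 * 1 = 2 by rfl, v1, ← hq] at q1
  rw [show 2 * 21 = 42 by rfl, v2, ← hl] at l1
  push_cast at q1 l1
  rw [abs_le] at q1 l1
  obtain ⟨q1, q2⟩ := q1
  obtain ⟨l1, l2⟩ := l1
  have lpos : 0 < l := by linarith
  set c := q / (4 * l) with hc
  have hcl : c * (4 * l) = q := by rw [hc]; field_simp
  have c1 : |1000000 * c - 410510| ≤ 2 := by
    rw [abs_le]; constructor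
    · have : 410508 ≤ 1000000 * c := by
        by_contra hh
        push Not at hh
        nlinarith
      linarith
    · have : 1000000 * c ≤ 410512 := by
        by_contra hh
        push Not at hh
        nlinarith
      linarith
  set s := √(1 - c ^ 2) with hs
  obtain ⟨c2, c3⟩ := abs_le.1 c1
  have hs2 : s ^ 2 = 1 - c ^ 2 := by
    rw [hs, Real.sq_sqrt]; nlinarith
  have hs0 : 0 ≤ s := Real.sqrt_nonneg _
  have s1 : |1000000 * s - 911856| ≤ 2 := by
    rw [abs_le]; constructor
    · have : 911854 ≤ 1000000 * s := by
        by_contra hh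
        push Not at hh
        nlinarith
      linarith
    · have : 1000000 * s ≤ 911858 := by
        by_contra hh
        push Not at hh
        nlinarith
      linarith
  have hcs : c ^ 2 + s ^ 2 = 1 := by linarith
  obtain ⟨s3, s4⟩ := abs_le.1 s1
  -- approximations
  have hU : ∀ κ, ∀ i < 32, |1000000 * TU bx l κ i - UI κ i| ≤ 12 := by
    intro κ i hi
    obtain ⟨a, b⟩ := abs_le.1 (h.ax i hi)
    unfold TU UI
    rw [v2]
    split_ifs
    · push_cast; rw [abs_le]; constructor <;> linarith
    · rw [abs_le]; constructor <;> linarith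
  have perr : ∀ {A B a b δ : ℝ}, |1000000 * A - a| ≤ 2 → |1000000 * B - b| ≤ δ → δ ≤ 12 →
      |b| ≤ 6000000 → 0 ≤ a → a ≤ 1000000 →
      |1000000000000 * (A * B) - a * b| ≤ 24 + 12000000 + 1000000 * δ := by
    intro A B a b δ h1 h2 h3 h4 h5 h6
    have e : 1000000000000 * (A * B) - a * b = (1000000 * A - a) * (1000000 * B - b)
        + (1000000 * A - a) * b + a * (1000000 * B - b) := by ring
    have g1 : |(1000000 * A - a) * (1000000 * B - b)| ≤ 2 * 12 := by
      rw [abs_mul]; exact mul_le_mul h1 (h2.trans h3) (abs_nonneg _) (by norm_num)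
    have g2 : |(1000000 * A - a) * b| ≤ 2 * 6000000 := by
      rw [abs_mul]; exact mul_le_mul h1 h4 (abs_nonneg _) (by norm_num)
    have g3 : |a * (1000000 * B - b)| ≤ 1000000 * δ := by
      rw [abs_mul, abs_of_nonneg h5]; exact mul_le_mul h6 h2 (abs_nonneg _) (by norm_num)
    rw [e]
    have g4 := abs_add_le ((1000000 * A - a) * (1000000 * B - b)
        + (1000000 * A - a) * b) (a * (1000000 * B - b))
    have g5 := abs_add_le ((1000000 * A - a) * (1000000 * B - b)) ((1000000 * A - a) * b)
    linarith
  let X : ℕ → ℝ := fun v => TX bx bv q l c s (kd v) (bi v)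
  let Y : ℕ → ℝ := fun v => TY bx bv l c s (kd v) (bi v)
  have cast6 : ∀ z : ℤ, ∀ m : ℕ, z.natAbs ≤ m → |(z : ℝ)| ≤ m := by
    intro z m hz
    rw [← Int.cast_abs, Int.abs_eq_natAbs]
    exact_mod_cast hz
  refine ⟨X, Y, ?_, ?_, ?_⟩
  · intro v hv
    obtain ⟨b1, b2, b3, b4, -⟩ := chkV v hv
    have b2' := cast6 _ _ b2
    have b3' := cast6 _ _ b3
    have b4' := abs_le.1 (cast6 _ _ b4)
    push_cast at b2' b3' b4'
    have u := hU (kd v) (bi v) b1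
    have w := h.av (bi v) b1
    have p1 := abs_le.1 (perr c1 u le_rfl b2' (by norm_num) (by norm_num))
    have p2 := abs_le.1 (perr s1 w (by norm_num) b3' (by norm_num) (by norm_num))
    have u' := abs_le.1 u
    simp only [X, TX, TX0]
    simp only [XJ, XI, v1] at b4'
    obtain ⟨b5, b6⟩ := b4'
    obtain ⟨p3, p4⟩ := p1
    obtain ⟨p5, p6⟩ := p2
    obtain ⟨u3, u4⟩ := u'
    rw [abs_le]
    split_ifs at b5 b6 ⊢ <;> push_cast at b5 b6 <;> constructor <;> linarith
  · intro v hv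
    obtain ⟨b1, b2, b3, -, b4⟩ := chkV v hv
    have b2' := cast6 _ _ b2
    have b3' := cast6 _ _ b3
    have b4' := abs_le.1 (cast6 _ _ b4)
    push_cast at b2' b3' b4'
    have u := hU (kd v) (bi v) b1
    have w := h.av (bi v) b1
    have p1 := abs_le.1 (perr s1 u le_rfl b2' (by norm_num) (by norm_num))
    have p2 := abs_le.1 (perr c1 w (by norm_num) b3' (by norm_num) (by norm_num))
    have w' := abs_le.1 w
    simp only [Y, TY]
    simp only [YI] at b4'
    obtain ⟨b5, b6⟩ := b4'
    obtain ⟨p3, p4⟩ := p1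
    obtain ⟨p5, p6⟩ := p2
    obtain ⟨w3, w4⟩ := w'
    rw [abs_le]
    split_ifs at b5 b6 ⊢ <;> push_cast at b5 b6 <;> constructor <;> linarith
  · have hV : ∀ κ i, goodV κ i → X (VT κ i) = TX bx bv q l c s κ i ∧
        Y (VT κ i) = TY bx bv l c s κ i := by
      intro κ i hg
      rcases hg with ⟨a, b⟩ | ⟨rfl, rfl, a, b⟩ | ⟨rfl, rfl, a, b⟩ | ⟨rfl, rfl, a, b⟩ |
        ⟨hi, rfl, a, b⟩ | ⟨hi, rfl, a, b⟩
      · simp only [X, Y, a, b, and_self]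
      · simp only [X, Y, a, b]
        simp [TX, TX0, TY, TU, h.hx0, h.hv0]
      · simp only [X, Y, a, b]
        simp [TX, TX0, TY, TU, h.hx0, h.hv0, h.hv1, hq]
      · simp only [X, Y, a, b]
        simp [TX, TX0, TY, TU, h.hx0, h.hv0]
        linarith
      · have hb : bx i = l := by
          rcases hi with rfl | rfl
          · rfl
          · exact h.hl
        simp only [X, Y, a, b]
        have e2 : 2 * l - l = l := by ring
        simp [TX, TX0, TY, TU, hb, e2]
      · have hb : bx i = l := by
          rcases hi with rfl | rfl
          · rfl
          · exact h.hl
        simp only [X, Y, a, b]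
        have e2 : 2 * l - l = l := by ring
        simp [TX, TX0, TY, TU, hb, e2]
    intro e he
    rw [← chkEK, List.mem_map] at he
    obtain ⟨p, hp, rfl⟩ := he
    obtain ⟨k1, k2⟩ := chkEK2 p hp
    obtain ⟨g1, g2⟩ := chkEK3 p hp
    obtain ⟨x1, y1⟩ := hV _ _ g1
    obtain ⟨x2, y2⟩ := hV _ _ g2
    have d := T_dist bx bv q l c s hcs p.1 (ea p.2) (eb p.2)
    rw [h.hE p.2 k1, ← x1, ← x2, ← y1, ← y2] at d
    simp only [← k2]
    rw [← d]
    unfold srt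
    split_ifs
    · rfl
    · simp only; ring

def EL : List (Fin 62 × Fin 62) := EN.map (fun p => (Fin.ofNat 62 p.1, Fin.ofNat 62 p.2))

theorem EL_mem {e : Fin 62 × Fin 62} : e ∈ EL ↔ ((e.1 : ℕ), (e.2 : ℕ)) ∈ EN := by
  unfold EL
  rw [List.mem_map]
  constructor
  · rintro ⟨p, hp, rfl⟩
    obtain ⟨h1, h2⟩ := chkLt p hp
    simpa [Fin.ofNat, Nat.mod_eq_of_lt h2, Nat.mod_eq_of_lt (h1.trans h2)] using hp
  · intro h
    refine ⟨_, h, ?_⟩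
    ext <;> simp [Fin.ofNat, Nat.mod_eq_of_lt]

theorem chkELN : EL.Nodup := by decide +kernel
theorem chkELd : ∀ v : Fin 62, (EL.filter (fun e => e.1 = v ∨ e.2 = v)).length = 4 := by
  decide +kernel
theorem chkELx : (EL.filter (fun e => ¬ (((e.1 : ℕ), (e.2 : ℕ)) = (9, 19) ∨
    ((e.1 : ℕ), (e.2 : ℕ)) = (13, 17)))).length = 122 := by
  decide +kernel

theorem card_filter_EL (p : Fin 62 × Fin 62 → Prop) [DecidablePred p] :
    (EL.toFinset.filter p).card = (EL.filter (fun e => p e)).length := by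
  rw [← List.toFinset_card_of_nodup (chkELN.filter _)]
  refine congrArg Finset.card (Finset.ext fun e => ?_)
  simp only [Finset.mem_filter, List.mem_toFinset, List.mem_filter, decide_eq_true_eq]

end NM

open scoped Classical

theorem near_matchstick_62 :
    ∃ (P : Fin 62 → EuclideanSpace ℝ (Fin 2)) (E : Finset (Fin 62 × Fin 62)),
      Function.Injective P ∧
      (∀ e ∈ E, e.1 < e.2) ∧
      E.card = 124 ∧
      (∀ v : Fin 62, (E.filter (fun e => e.1 = v ∨ e.2 = v)).card = 4) ∧
      (∀ e ∈ E, ∀ f ∈ E, e ≠ f →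
        ∀ x ∈ segment ℝ (P e.1) (P e.2) ∩ segment ℝ (P f.1) (P f.2),
          (x = P e.1 ∨ x = P e.2) ∧ (x = P f.1 ∨ x = P f.2)) ∧
      (E.filter (fun e => dist (P e.1) (P e.2) = 1)).card = 122 ∧
      (∃ t : ℝ, |t - 1| < 0.034 ∧
        ∀ e ∈ E, dist (P e.1) (P e.2) = 1 ∨ dist (P e.1) (P e.2) = t) := by
  obtain ⟨bx, bv, s2, hS⟩ := NM.exists_Sol
  obtain ⟨X, Y, hX, hY, hd⟩ := NM.main_real hS
  obtain ⟨a1, a2⟩ := abs_le.1 hS.as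
  have hdist : ∀ e ∈ NM.EL, dist (!₂[X e.1, Y e.1] : NM.E2) !₂[X e.2, Y e.2]
      = if ((e.1 : ℕ), (e.2 : ℕ)) = (9, 19) ∨ ((e.1 : ℕ), (e.2 : ℕ)) = (13, 17)
        then √s2 else 1 := by
    intro e he
    have := hd _ (NM.EL_mem.1 he)
    rw [EuclideanSpace.dist_eq, Fin.sum_univ_two]
    simp only [Matrix.cons_val_zero, Matrix.cons_val_one, Real.dist_eq, sq_abs]
    rw [this]
    split_ifs
    · rfl
    · exact Real.sqrt_one
  have t1 : √s2 < 0.99 := by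
    rw [Real.sqrt_lt' (by norm_num)]; norm_num; linarith
  have t2 : 0.97 < √s2 := by
    apply Real.lt_sqrt_of_sq_lt; norm_num; linarith
  refine ⟨fun v => !₂[X v, Y v], NM.EL.toFinset, ?_, ?_, ?_, ?_, ?_, ?_, ?_⟩
  · intro v w h
    exact Fin.ext (NM.pt_inj X Y hX hY v.2 w.2 h)
  · intro e he
    exact (NM.chkLt _ (NM.EL_mem.1 (List.mem_toFinset.1 he))).1
  · rw [List.toFinset_card_of_nodup NM.chkELN]; rfl
  · intro v
    rw [NM.card_filter_EL, ← NM.chkELd v]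
  · intro e he f hf hef
    apply NM.noncross X Y hX hY (NM.EL_mem.1 (List.mem_toFinset.1 he))
      (NM.EL_mem.1 (List.mem_toFinset.1 hf))
    intro h
    apply hef
    rw [Prod.mk.injEq] at h
    exact Prod.ext (Fin.ext h.1) (Fin.ext h.2)
  · rw [← NM.chkELx, ← NM.card_filter_EL]
    refine congrArg Finset.card (Finset.ext fun e => ?_)
    simp only [Finset.mem_filter]
    apply and_congr_right
    intro he
    rw [hdist e (List.mem_toFinset.1 he)]
    split_ifs with h
    · simp only [h, not_true_eq_false, iff_false]
      intro h1; rw [h1] at t1; norm_num at t1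
    · simp only [h, not_false_eq_true]
  · refine ⟨√s2, ?_, ?_⟩
    · rw [abs_lt]; constructor <;> norm_num at * <;> linarith
    · intro e he
      rw [hdist e (List.mem_toFinset.1 he)]
      split_ifs
      · right; rfl
      · left; rfl
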